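/- Let T be a tree in 𝒯, let v ∈ A_T with N_T(v) = {u₁,u₂,u₃}, and let T′ be the tree obtained from T by contracting the three edges vu₁, vu₂, vu₃ into one new vertex w; concretely, T′ has vertex set (V(T) \ {v,u₁,u₂,u₃}) ∪ {w}, two vertices of V(T) \ {v,u₁,u₂,u₃} are adjacent in T′ if and only if they are adjacent in T, and w is adjacent in T′ exactly to those vertices of V(T) \ {v,u₁,u₂,u₃} that are adjacent in T to u₁, u₂ or u₃. Then T′ ∈ 𝒯, D_{T′} = {w} ∪ (D_T \ N_T(v)), and A_{T′} = A_T \ {v}. -/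

import Mathlib

open SimpleGraph

namespace URPaper

/-- `M` is a matching in the simple graph `G`: a finite set of edges of `G`
that are pairwise vertex-disjoint. -/
def IsMatchingSet {V : Type*} (G : SimpleGraph V) (M : Finset (Sym2 V)) : Prop :=
  (∀ e ∈ M, e ∈ G.edgeSet) ∧
    ∀ e ∈ M, ∀ f ∈ M, e ≠ f → ∀ v : V, v ∈ e → v ∉ f

/-- The set of vertices covered by a set of edges. -/
def covered {V : Type*} (M : Finset (Sym2 V)) : Set V := {v | ∃ e ∈ M, v ∈ e}

/-- A matching `M` in `G` is uniquely restricted if no other matching of `G`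
covers exactly the same set of vertices. -/
def IsURMatching {V : Type*} (G : SimpleGraph V) (M : Finset (Sym2 V)) : Prop :=
  IsMatchingSet G M ∧
    ∀ M' : Finset (Sym2 V), IsMatchingSet G M' → covered M' = covered M → M' = M

/-- The matching number `ν(G)`: the maximum size of a matching in `G`. -/
noncomputable def nu {V : Type*} (G : SimpleGraph V) : ℕ :=
  sSup {k | ∃ M : Finset (Sym2 V), IsMatchingSet G M ∧ M.card = k}

/-- The uniquely restricted matching number `ν_ur(G)`: the maximum size of a
uniquely restricted matching in `G`. -/
noncomputable def nuUR {V : Type*} (G : SimpleGraph V) : ℕ :=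
  sSup {k | ∃ M : Finset (Sym2 V), IsURMatching G M ∧ M.card = k}

/-- `D_G`: the set of vertices missed by at least one maximum matching of `G`. -/
def gallaiD {V : Type*} (G : SimpleGraph V) : Set V :=
  {v | ∃ M : Finset (Sym2 V), IsMatchingSet G M ∧ M.card = nu G ∧ v ∉ covered M}

/-- `A_G`: the set of vertices outside `D_G` having a neighbor in `D_G`. -/
def gallaiA {V : Type*} (G : SimpleGraph V) : Set V :=
  {v | v ∉ gallaiD G ∧ ∃ u ∈ gallaiD G, G.Adj v u}

/-- `C_G = V(G) \ (A_G ∪ D_G)`. -/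
def gallaiC {V : Type*} (G : SimpleGraph V) : Set V :=
  {v | v ∉ gallaiD G ∧ v ∉ gallaiA G}

/-- Membership in the family `𝒯`: trees `T` with `ν(T) = (n(T) - 1)/3`
(equivalently `3 ν(T) + 1 = n(T)`) such that every vertex of `A_T` has degree
at most `3` in `T`. -/
def MemT {V : Type*} (T : SimpleGraph V) : Prop :=
  T.IsTree ∧ (∀ v ∈ gallaiA T, (T.neighborSet v).ncard ≤ 3) ∧
    3 * nu T + 1 = Nat.card V

/-- The graph obtained from `T` by contracting the set `S` to a single new
vertex (the vertex `none`), all other vertices being kept. -/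
def contractSet {V : Type*} (T : SimpleGraph V) (S : Set V) :
    SimpleGraph (Option {x : V // x ∉ S}) where
  Adj a b :=
    match a, b with
    | some x, some y => T.Adj x y
    | some x, none => ∃ u ∈ S, T.Adj (x : V) u
    | none, some y => ∃ u ∈ S, T.Adj (y : V) u
    | none, none => False
  symm := by
    constructor
    rintro (_ | x) (_ | y) h
    · exact h
    · exact h
    · exact h
    · exact T.adj_symm h
  loopless := by
    constructor
    rintro (_ | x) h
    · exact h
    · exact T.irrefl h

/-- The graph `BG1` from the paper, given by an explicit edge list. -/
def BG1 : SimpleGraph (Fin 10) :=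
  SimpleGraph.fromEdgeSet {s(0,4), s(1,4), s(0,5), s(2,5), s(0,6), s(3,6), s(1,7), s(2,7), s(1,8), s(3,8), s(2,9), s(3,9)}

/-- The graph `BG2` from the paper, given by an explicit edge list. -/
def BG2 : SimpleGraph (Fin 13) :=
  SimpleGraph.fromEdgeSet {s(0,4), s(1,4), s(0,5), s(2,5), s(0,6), s(3,6), s(1,7), s(2,7), s(1,8), s(3,8), s(2,9), s(3,9), s(10,6), s(10,7), s(11,8), s(11,5), s(12,4), s(12,9)}

/-- The graph `BG3` from the paper, given by an explicit edge list. -/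
def BG3 : SimpleGraph (Fin 16) :=
  SimpleGraph.fromEdgeSet {s(0,1), s(1,2), s(2,3), s(3,4), s(4,5), s(5,0), s(6,7), s(7,8), s(8,9), s(9,10), s(10,11), s(11,6), s(12,0), s(12,6), s(13,2), s(13,8), s(14,4), s(14,10), s(15,12), s(15,13), s(15,14)}

/-- The graph `BG4` from the paper, given by an explicit edge list. -/
def BG4 : SimpleGraph (Fin 19) :=
  SimpleGraph.fromEdgeSet {s(0,1), s(1,2), s(2,3), s(3,4), s(4,5), s(5,0), s(6,7), s(7,8), s(8,9), s(9,10), s(10,11), s(11,6), s(12,0), s(13,1), s(14,2), s(15,3), s(16,4), s(17,5), s(12,6), s(13,7), s(14,8), s(15,9), s(16,10), s(17,11), s(18,12), s(18,14), s(18,16)}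

/-- The graph `BG5` from the paper, given by an explicit edge list. -/
def BG5 : SimpleGraph (Fin 16) :=
  SimpleGraph.fromEdgeSet {s(0,4), s(1,4), s(0,5), s(2,5), s(0,6), s(3,6), s(1,7), s(2,7), s(1,8), s(3,8), s(2,9), s(3,9), s(10,6), s(10,7), s(11,8), s(11,5), s(12,4), s(12,9), s(13,14), s(14,15), s(13,10), s(13,11), s(15,12)}

/-- The graph `BG6` from the paper, given by an explicit edge list. -/
def BG6 : SimpleGraph (Fin 19) :=
  SimpleGraph.fromEdgeSet {s(0,4), s(1,4), s(0,5), s(2,5), s(0,6), s(3,6), s(1,7), s(2,7), s(1,8), s(3,8), s(2,9), s(3,9), s(10,6), s(10,7), s(11,8), s(11,5), s(12,4), s(12,9), s(13,14), s(14,15), s(15,16), s(16,17), s(17,18), s(18,13), s(13,10), s(15,11), s(17,12)}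

/-- The graph `BG7` from the paper, given by an explicit edge list. -/
def BG7 : SimpleGraph (Fin 19) :=
  SimpleGraph.fromEdgeSet {s(0,1), s(1,2), s(2,3), s(3,4), s(4,5), s(5,0), s(6,7), s(7,8), s(8,9), s(9,10), s(10,11), s(11,6), s(12,0), s(12,6), s(13,2), s(13,8), s(14,4), s(14,10), s(15,12), s(15,13), s(15,14), s(17,16), s(16,18), s(17,9), s(17,5), s(18,3), s(18,11)}

/-- The graph `BG8` from the paper, given by an explicit edge list. -/
def BG8 : SimpleGraph (Fin 22) :=
  SimpleGraph.fromEdgeSet {s(0,1), s(1,2), s(2,3), s(3,4), s(4,5), s(5,0), s(6,7), s(7,8), s(8,9), s(9,10), s(10,11), s(11,6), s(12,0), s(13,1), s(14,2), s(15,3), s(16,4), s(17,5), s(12,6), s(13,7), s(14,8), s(15,9), s(16,10), s(17,11), s(18,12), s(18,14), s(18,16), s(19,20), s(20,21), s(19,13), s(19,15), s(21,17)}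

/-- The graph `BG9` from the paper, given by an explicit edge list. -/
def BG9 : SimpleGraph (Fin 25) :=
  SimpleGraph.fromEdgeSet {s(0,1), s(1,2), s(2,3), s(3,4), s(4,5), s(5,0), s(6,7), s(7,8), s(8,9), s(9,10), s(10,11), s(11,6), s(12,0), s(13,1), s(14,2), s(15,3), s(16,4), s(17,5), s(12,6), s(13,7), s(14,8), s(15,9), s(16,10), s(17,11), s(18,12), s(18,14), s(18,16), s(19,20), s(20,21), s(21,22), s(22,23), s(23,24), s(24,19), s(19,13), s(21,15), s(23,17)}

/-- The graph `GraphH1` from the paper, given by an explicit edge list. -/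
def GraphH1 : SimpleGraph (Fin 14) :=
  SimpleGraph.fromEdgeSet {s(0,4), s(1,4), s(0,5), s(2,5), s(0,6), s(3,6), s(1,7), s(2,7), s(1,8), s(3,8), s(2,9), s(3,9), s(10,6), s(10,7), s(11,8), s(11,5), s(12,4), s(12,9), s(13,10), s(13,11), s(13,12)}

/-- The graph `GraphH2` from the paper, given by an explicit edge list. -/
def GraphH2 : SimpleGraph (Fin 20) :=
  SimpleGraph.fromEdgeSet {s(0,1), s(1,2), s(2,3), s(3,4), s(4,5), s(5,0), s(6,7), s(7,8), s(8,9), s(9,10), s(10,11), s(11,6), s(12,0), s(13,1), s(14,2), s(15,3), s(16,4), s(17,5), s(12,6), s(13,7), s(14,8), s(15,9), s(16,10), s(17,11), s(18,12), s(18,14), s(18,16), s(19,13), s(19,15), s(19,17)}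

/-- Membership in the family `ℬ = {G₁, …, G₉}`, up to isomorphism. -/
def IsBlockB : ∀ (X : Type), SimpleGraph X → Prop := fun _ H =>
  Nonempty (H ≃g BG1) ∨ Nonempty (H ≃g BG2) ∨ Nonempty (H ≃g BG3) ∨
  Nonempty (H ≃g BG4) ∨ Nonempty (H ≃g BG5) ∨ Nonempty (H ≃g BG6) ∨
  Nonempty (H ≃g BG7) ∨ Nonempty (H ≃g BG8) ∨ Nonempty (H ≃g BG9)

/-- Membership in the family `ℬ_c = {G₁, G₂, G₃, G₄}`, up to isomorphism. -/
def IsBlockBc : ∀ (X : Type), SimpleGraph X → Prop := fun _ H =>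
  Nonempty (H ≃g BG1) ∨ Nonempty (H ≃g BG2) ∨ Nonempty (H ≃g BG3) ∨ Nonempty (H ≃g BG4)

/-- `G` (on vertex set `W`) arises from the tree `T` (on vertex set `V`) by
replacing every vertex of `S` by a graph from the family `𝓑`.  The map `π`
sends every vertex of `G` to the vertex of `T` it corresponds to:
* every fiber over a vertex outside `S` is a single vertex, and on these
  vertices `π` is an isomorphism with the corresponding induced subgraph of `T`;
* the fiber over a vertex `s ∈ S` induces a graph of the family `𝓑`;
* there are no edges between the fibers of two distinct vertices of `S`;
* for `s ∈ S` and `v ∉ S`, there is exactly one edge of `G` between the two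
  fibers if `sv ∈ E(T)` and none otherwise;
* each vertex of a fiber over `s ∈ S` has at most one neighbor outside this
  fiber (distinct attachment vertices), and a vertex of such a fiber having a
  neighbor outside the fiber has exactly two neighbors inside it
  (attachment only at vertices of degree `2` of the replacing graph). -/
def ArisesFrom (𝓑 : ∀ (X : Type), SimpleGraph X → Prop) {W V : Type}
    (G : SimpleGraph W) (T : SimpleGraph V) (S : Set V) (π : W → V) : Prop :=
  Function.Surjective π ∧
  (∀ v ∉ S, ∀ w w' : W, π w = v → π w' = v → w = w') ∧
  (∀ w w' : W, π w ∉ S → π w' ∉ S → (G.Adj w w' ↔ T.Adj (π w) (π w'))) ∧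
  (∀ s ∈ S, 𝓑 _ (G.induce (π ⁻¹' {s}))) ∧
  (∀ s ∈ S, ∀ s' ∈ S, s ≠ s' → ∀ w w' : W, π w = s → π w' = s' → ¬ G.Adj w w') ∧
  (∀ s ∈ S, ∀ v ∉ S, T.Adj s v →
    ∃! p : W × W, π p.1 = s ∧ π p.2 = v ∧ G.Adj p.1 p.2) ∧
  (∀ s ∈ S, ∀ v ∉ S, ¬ T.Adj s v →
    ∀ w w' : W, π w = s → π w' = v → ¬ G.Adj w w') ∧
  (∀ s ∈ S, ∀ w : W, π w = s → ∀ w₁ w₂ : W, π w₁ ≠ s → π w₂ ≠ s →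
    G.Adj w w₁ → G.Adj w w₂ → w₁ = w₂) ∧
  (∀ s ∈ S, ∀ w : W, π w = s → ∀ w' : W, π w' ≠ s → G.Adj w w' →
    (G.neighborSet w ∩ π ⁻¹' {s}).ncard = 2)

/-- Membership in the family `𝒢`: graphs arising from a tree `T ∈ 𝒯` by
replacing each vertex of a subset `S ⊆ D_T` by a graph of the family `ℬ`. -/
def InCalG {W : Type} (G : SimpleGraph W) : Prop :=
  ∃ (V : Type) (T : SimpleGraph V) (S : Set V) (π : W → V),
    Finite V ∧ MemT T ∧ S ⊆ gallaiD T ∧ ArisesFrom IsBlockB G T S π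

/-- `κ_G(P)`: the number of connected components of `G` whose induced graph
satisfies the (isomorphism invariant) predicate `P`. -/
noncomputable def kappa {W : Type} (G : SimpleGraph W)
    (P : ∀ (X : Type), SimpleGraph X → Prop) : ℕ :=
  Nat.card {c : G.ConnectedComponent // P _ (G.induce c.supp)}

/-- Membership in `𝒢₃`: cubic graphs of girth at least `5`. -/
def IsCubicGirth5 : ∀ (X : Type), SimpleGraph X → Prop := fun _ H =>
  (∀ v, (H.neighborSet v).ncard = 3) ∧ 5 ≤ H.egirth

/-- Being isomorphic to `H₁` or `H₂`. -/
def IsH1orH2 : ∀ (X : Type), SimpleGraph X → Prop := fun _ H =>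
  Nonempty (H ≃g GraphH1) ∨ Nonempty (H ≃g GraphH2)

lemma degree_eq_ncard {V : Type*} [Fintype V] (T : SimpleGraph V) [DecidableRel T.Adj] (a : V) :
    (T.neighborSet a).ncard = T.degree a := by
  rw [← T.card_neighborSet_eq_degree, ← Nat.card_eq_fintype_card, Nat.card_coe_set_eq]

lemma exists_parent {V : Type*} {T : SimpleGraph V} (hT : T.IsTree) (r : V) :
    ∃ p : V → V, ∀ u v, T.Adj u v → (u ≠ r ∧ p u = v) ∨ (v ≠ r ∧ p v = u) := by
  classical
  choose f hf hf' using (hT.existsUnique_path · r)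
  refine ⟨fun v => (f v).snd, fun u v huv => ?_⟩
  by_cases h : u ∈ (f v).support
  · right
    refine ⟨?_, (hT.isAcyclic.eq_snd_of_adj_start (hf v) huv.symm h).symm⟩
    rintro rfl
    have := hf' v .nil Walk.IsPath.nil
    rw [← this] at h
    simp at h
    exact huv.ne h
  · left
    have := hf' u (.cons huv (f v)) ((Walk.cons_isPath_iff _ _).2 ⟨hf v, h⟩)
    refine ⟨?_, by simp [← this]⟩
    rintro rfl
    exact h (Walk.end_mem_support _)

lemma bdd_nu {V : Type*} [Finite V] (T : SimpleGraph V) :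
    BddAbove {k | ∃ M : Finset (Sym2 V), IsMatchingSet T M ∧ M.card = k} := by
  classical
  have := Fintype.ofFinite V
  refine ⟨Fintype.card (Sym2 V), ?_⟩
  rintro k ⟨M, -, rfl⟩
  exact Finset.card_le_univ M

lemma card_le_nu {V : Type*} [Finite V] {T : SimpleGraph V} {M : Finset (Sym2 V)}
    (hM : IsMatchingSet T M) : M.card ≤ nu T :=
  le_csSup (bdd_nu T) ⟨M, hM, rfl⟩

lemma exists_max {V : Type*} [Finite V] (T : SimpleGraph V) :
    ∃ M : Finset (Sym2 V), IsMatchingSet T M ∧ M.card = nu T :=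
  Nat.sSup_mem (s := {k | ∃ M : Finset (Sym2 V), IsMatchingSet T M ∧ M.card = k})
    ⟨0, ∅, ⟨by simp, by simp⟩, rfl⟩ (bdd_nu T)

lemma nu_of_bip {V : Type*} [Fintype V] {T : SimpleGraph V} (hT : T.IsTree) (A : Finset V)
    (hA : ∀ a b, T.Adj a b → (a ∈ A ↔ b ∉ A)) (hd : ∀ a ∈ A, 2 ≤ (T.neighborSet a).ncard) :
    nu T = A.card ∧ gallaiD T = {x | x ∉ A} ∧ gallaiA T = {x | x ∈ A} := by
  classical
  have key : ∀ d, d ∉ A → ∃ M : Finset (Sym2 V), IsMatchingSet T M ∧ M.card = A.card ∧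
      d ∉ covered M := by
    intro d hdA
    obtain ⟨p, hp⟩ := exists_parent hT d
    have hc : ∀ a : V, ∃ c, a ∈ A → T.Adj a c ∧ c ≠ d ∧ p c = a := by
      intro a
      by_cases ha : a ∈ A
      · obtain ⟨c, hc, hne⟩ := Set.exists_ne_of_one_lt_ncard (hd a ha) (p a)
        refine ⟨c, fun _ => ⟨hc, ?_⟩⟩
        rcases hp a c hc with h | h
        · exact absurd h.2.symm hne
        · exact h
      · exact ⟨a, fun h => absurd h ha⟩
    choose c hc using hc
    have hcA : ∀ a ∈ A, c a ∉ A := fun a ha => (hA _ _ (hc a ha).1).1 ha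
    refine ⟨A.image fun a => s(a, c a), ⟨?_, ?_⟩, ?_, ?_⟩
    · intro e he
      obtain ⟨a, ha, rfl⟩ := Finset.mem_image.1 he
      exact (hc a ha).1
    · intro e he f hf hne x hxe hxf
      obtain ⟨a, ha, rfl⟩ := Finset.mem_image.1 he
      obtain ⟨b, hb, rfl⟩ := Finset.mem_image.1 hf
      apply hne
      have hab : a = b := by
        rcases Sym2.mem_iff.1 hxe with h | h <;> rcases Sym2.mem_iff.1 hxf with h' | h'
        · exact h.symm.trans h'
        · exact absurd (h.symm.trans h' ▸ ha) (hcA b hb)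
        · exact absurd (h'.symm.trans h ▸ hb) (hcA a ha)
        · rw [← (hc a ha).2.2, ← (hc b hb).2.2, ← h, ← h']
      rw [hab]
    · apply Finset.card_image_of_injOn
      intro a ha b hb hab
      rcases Sym2.eq_iff.1 hab with h | h
      · exact h.1
      · exact absurd (h.1 ▸ ha) (hcA b hb)
    · rintro ⟨e, he, hde⟩
      obtain ⟨a, ha, rfl⟩ := Finset.mem_image.1 he
      rcases Sym2.mem_iff.1 hde with h | h
      · exact hdA (h ▸ ha)
      · exact (hc a ha).2.1 h.symm
  have up : ∀ M, IsMatchingSet T M → M.card ≤ A.card ∧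
      (M.card = A.card → ∀ a ∈ A, a ∈ covered M) := by
    intro M hM
    have hg : ∀ e : Sym2 V, ∃ a, e ∈ M → a ∈ A ∧ a ∈ e := by
      intro e
      by_cases he : e ∈ M
      · induction e using Sym2.ind with
        | _ x y =>
          have hxy : T.Adj x y := hM.1 _ he
          by_cases hx : x ∈ A
          · exact ⟨x, fun _ => ⟨hx, by simp⟩⟩
          · refine ⟨y, fun _ => ⟨?_, by simp⟩⟩
            by_contra hy
            exact hx ((hA _ _ hxy).2 hy)
      · have : Nonempty V := hT.connected.nonempty
        exact ⟨Classical.arbitrary V, fun h => absurd h he⟩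
    choose g hg using hg
    have hinj : Set.InjOn g M := by
      intro e he f hf hef
      by_contra hne
      exact hM.2 e he f hf hne (g e) (hg e he).2 (hef ▸ (hg f hf).2)
    have hsub : M.image g ⊆ A := by
      intro x hx
      obtain ⟨e, he, rfl⟩ := Finset.mem_image.1 hx
      exact (hg e he).1
    have hcard := Finset.card_image_of_injOn hinj
    refine ⟨hcard ▸ Finset.card_le_card hsub, fun h a ha => ?_⟩
    have := Finset.eq_of_subset_of_card_le hsub (by rw [hcard, h])
    rw [← this] at ha
    obtain ⟨e, he, rfl⟩ := Finset.mem_image.1 ha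
    exact ⟨e, he, (hg e he).2⟩
  have hex : ∃ d, d ∉ A := by
    by_contra! h
    have : Nonempty V := hT.connected.nonempty
    let a := Classical.arbitrary V
    have h2 := hd a (h a)
    obtain ⟨c, hc, -⟩ := Set.exists_ne_of_one_lt_ncard h2 a
    exact (hA _ _ hc).1 (h a) (h c)
  have hnu : nu T = A.card := by
    obtain ⟨d, hd'⟩ := hex
    obtain ⟨M, hM, hc, -⟩ := key d hd'
    obtain ⟨N, hN, hNc⟩ := exists_max T
    have := (up N hN).1
    have := card_le_nu hM
    omega
  have hD : gallaiD T = {x | x ∉ A} := by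
    ext x
    constructor
    · rintro ⟨M, hM, hc, hx⟩ hxA
      exact hx ((up M hM).2 (hc.trans hnu) x hxA)
    · intro hx
      obtain ⟨M, hM, hc, hx⟩ := key x hx
      exact ⟨M, hM, hc.trans hnu.symm, hx⟩
  refine ⟨hnu, hD, ?_⟩
  ext x
  simp only [gallaiA, hD, Set.mem_setOf_eq, not_not]
  refine ⟨fun h => h.1, fun hx => ⟨hx, ?_⟩⟩
  obtain ⟨c, hc, -⟩ := Set.exists_ne_of_one_lt_ncard (hd x hx) x
  exact ⟨c, (hA _ _ hc).1 hx, hc⟩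

lemma edge_cut {V : Type*} {T : SimpleGraph V} (hT : T.IsTree) {a b : V} (hab : T.Adj a b) :
    ∃ X : Set V, a ∈ X ∧ b ∉ X ∧ ∀ x y, T.Adj x y → s(x, y) ≠ s(a, b) → (x ∈ X ↔ y ∈ X) := by
  have hb := (isAcyclic_iff_forall_adj_isBridge.1 hT.isAcyclic) hab
  rw [isBridge_iff] at hb
  refine ⟨{x | (T.deleteEdges {s(a, b)}).Reachable a x}, Reachable.refl _, hb, ?_⟩
  intro x y hxy hne
  have h : (T.deleteEdges {s(a, b)}).Adj x y := by
    rw [deleteEdges_adj]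
    exact ⟨hxy, hne⟩
  exact ⟨fun h' => h'.trans h.reachable, fun h' => h'.trans h.symm.reachable⟩

/-- Mixing two maximum matchings along an edge cut. -/
lemma mix {V : Type*} [Finite V] {T : SimpleGraph V} {X : Set V} {e₀ : Sym2 V}
    (hX : ∀ x y, T.Adj x y → s(x, y) ≠ e₀ → (x ∈ X ↔ y ∈ X))
    {M N : Finset (Sym2 V)} (hM : IsMatchingSet T M) (hN : IsMatchingSet T N)
    (hMc : M.card = nu T) (hNc : N.card = nu T) (hMe : e₀ ∉ M) (hNe : e₀ ∉ N) :
    ∃ P : Finset (Sym2 V), IsMatchingSet T P ∧ P.card = nu T ∧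
      ∀ e, e ∈ P ↔ (e ∈ M ∧ ∀ x ∈ e, x ∈ X) ∨ (e ∈ N ∧ ∀ x ∈ e, x ∉ X) := by
  classical
  have main : ∀ M N : Finset (Sym2 V), IsMatchingSet T M → IsMatchingSet T N →
      IsMatchingSet T (M.filter (fun e => ∀ x ∈ e, x ∈ X) ∪ N.filter (fun e => ∀ x ∈ e, x ∉ X)) ∧
      (M.filter (fun e => ∀ x ∈ e, x ∈ X) ∪ N.filter (fun e => ∀ x ∈ e, x ∉ X)).card
        = (M.filter (fun e => ∀ x ∈ e, x ∈ X)).card +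
          (N.filter (fun e => ∀ x ∈ e, x ∉ X)).card := by
    intro M N hM hN
    refine ⟨⟨?_, ?_⟩, ?_⟩
    · intro e he
      simp only [Finset.mem_union, Finset.mem_filter] at he
      rcases he with h | h
      · exact hM.1 e h.1
      · exact hN.1 e h.1
    · intro e he f hf hne x hxe hxf
      simp only [Finset.mem_union, Finset.mem_filter] at he hf
      rcases he with h | h <;> rcases hf with h' | h'
      · exact hM.2 e h.1 f h'.1 hne x hxe hxf
      · exact h'.2 x hxf (h.2 x hxe)
      · exact h.2 x hxe (h'.2 x hxf)
      · exact hN.2 e h.1 f h'.1 hne x hxe hxf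
    · apply Finset.card_union_of_disjoint
      rw [Finset.disjoint_left]
      intro e h h'
      simp only [Finset.mem_filter] at h h'
      induction e using Sym2.ind with
      | _ x y => exact h'.2 x (by simp) (h.2 x (by simp))
  have split : ∀ M : Finset (Sym2 V), IsMatchingSet T M → e₀ ∉ M →
      M.card ≤ (M.filter (fun e => ∀ x ∈ e, x ∈ X)).card +
          (M.filter (fun e => ∀ x ∈ e, x ∉ X)).card := by
    intro M hM he
    rw [← (main M M hM hM).2]
    apply Finset.card_le_card
    intro e heM
    simp only [Finset.mem_union, Finset.mem_filter]
    induction e using Sym2.ind with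
    | _ x y =>
      have := hX x y (hM.1 _ heM) (fun h => he (h ▸ heM))
      by_cases hx : x ∈ X
      · left
        refine ⟨heM, ?_⟩
        simp only [Sym2.mem_iff]
        rintro z (rfl | rfl)
        · exact hx
        · exact this.1 hx
      · right
        refine ⟨heM, ?_⟩
        simp only [Sym2.mem_iff]
        rintro z (rfl | rfl)
        · exact hx
        · exact fun h => hx (this.2 h)
  refine ⟨_, (main M N hM hN).1, ?_, ?_⟩
  · have h1 := card_le_nu (main M N hM hN).1
    have h2 := card_le_nu (main N M hN hM).1
    have h3 := (main M N hM hN).2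
    have h4 := (main N M hN hM).2
    have h5 := split M hM hMe
    have h6 := split N hN hNe
    omega
  · intro e
    simp only [Finset.mem_union, Finset.mem_filter]

lemma not_mem_of_not_covered {V : Type*} {M : Finset (Sym2 V)} {x y : V} (h : x ∉ covered M) :
    s(x, y) ∉ M := fun h' => h ⟨_, h', by simp⟩

lemma D_indep {V : Type*} [Finite V] {T : SimpleGraph V} (hT : T.IsTree) {a b : V}
    (ha : a ∈ gallaiD T) (hb : b ∈ gallaiD T) : ¬ T.Adj a b := by
  classical
  intro hab
  obtain ⟨M, hM, hMc, hMa⟩ := ha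
  obtain ⟨N, hN, hNc, hNb⟩ := hb
  obtain ⟨X, haX, hbX, hX⟩ := edge_cut hT hab
  obtain ⟨P, hP, hPc, hPe⟩ := mix hX hM hN hMc hNc (not_mem_of_not_covered hMa)
    (by rw [Sym2.eq_swap]; exact not_mem_of_not_covered hNb)
  have h1 : a ∉ covered P := by
    rintro ⟨e, he, hae⟩
    rcases (hPe e).1 he with h | h
    · exact hMa ⟨e, h.1, hae⟩
    · exact h.2 a hae haX
  have h2 : b ∉ covered P := by
    rintro ⟨e, he, hbe⟩
    rcases (hPe e).1 he with h | h
    · exact hbX (h.2 b hbe)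
    · exact hNb ⟨e, h.1, hbe⟩
  have h3 : IsMatchingSet T (insert s(a, b) P) := by
    refine ⟨?_, ?_⟩
    · intro e he
      rcases Finset.mem_insert.1 he with rfl | he
      · exact hab
      · exact hP.1 e he
    · intro e he f hf hne x hxe hxf
      rcases Finset.mem_insert.1 he with h0 | he1 <;> rcases Finset.mem_insert.1 hf with h0' | hf1
      · exact hne (h0.trans h0'.symm)
      · rw [h0] at hxe
        rcases Sym2.mem_iff.1 hxe with rfl | rfl
        · exact h1 ⟨f, hf1, hxf⟩
        · exact h2 ⟨f, hf1, hxf⟩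
      · rw [h0'] at hxf
        rcases Sym2.mem_iff.1 hxf with rfl | rfl
        · exact h1 ⟨e, he1, hxe⟩
        · exact h2 ⟨e, he1, hxe⟩
      · exact hP.2 e he1 f hf1 hne x hxe hxf
  have h4 := card_le_nu h3
  rw [Finset.card_insert_of_notMem (not_mem_of_not_covered h1)] at h4
  omega

lemma A_matched {V : Type*} [Finite V] {T : SimpleGraph V} (hT : T.IsTree) {a x : V}
    (ha : a ∈ gallaiA T) {M : Finset (Sym2 V)} (hM : IsMatchingSet T M) (hMc : M.card = nu T)
    (hax : s(a, x) ∈ M) : x ∈ gallaiD T := by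
  classical
  obtain ⟨-, d, hd, had⟩ := ha
  by_cases hxd : x = d
  · rwa [hxd]
  obtain ⟨N, hN, hNc, hNd⟩ := hd
  obtain ⟨X, haX, hdX, hX⟩ := edge_cut hT had
  have hMe : s(a, d) ∉ M := by
    intro h
    refine hM.2 _ h _ hax ?_ a (by simp) (by simp)
    intro h'
    rcases Sym2.eq_iff.1 h' with h | h
    · exact hxd h.2.symm
    · exact had.ne h.2.symm
  obtain ⟨P, hP, hPc, hPe⟩ := mix hX hM hN hMc hNc hMe
    (by rw [Sym2.eq_swap]; exact not_mem_of_not_covered hNd)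
  have hadj : T.Adj a x := hM.1 _ hax
  have hxX : x ∈ X := by
    refine (hX a x hadj ?_).1 haX
    intro h
    exact hMe (h ▸ hax)
  have haxP : s(a, x) ∈ P := by
    rw [hPe]
    left
    refine ⟨hax, ?_⟩
    simp only [Sym2.mem_iff]
    rintro z (rfl | rfl) <;> assumption
  have h2 : d ∉ covered P := by
    rintro ⟨e, he, hbe⟩
    rcases (hPe e).1 he with h | h
    · exact hdX (h.2 d hbe)
    · exact hNd ⟨e, h.1, hbe⟩
  have h1 : ∀ e ∈ P.erase s(a, x), a ∉ e := by
    intro e he hae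
    exact hP.2 e (Finset.mem_of_mem_erase he) _ haxP (Finset.ne_of_mem_erase he) a hae (by simp)
  have h1x : ∀ e ∈ P.erase s(a, x), x ∉ e := by
    intro e he hae
    exact hP.2 e (Finset.mem_of_mem_erase he) _ haxP (Finset.ne_of_mem_erase he) x hae (by simp)
  have h2' : ∀ e ∈ P.erase s(a, x), d ∉ e := by
    intro e he hae
    exact h2 ⟨e, Finset.mem_of_mem_erase he, hae⟩
  refine ⟨insert s(a, d) (P.erase s(a, x)), ⟨?_, ?_⟩, ?_, ?_⟩
  · intro e he
    rcases Finset.mem_insert.1 he with rfl | he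
    · exact had
    · exact hP.1 e (Finset.mem_of_mem_erase he)
  · intro e he f hf hne y hye hyf
    rcases Finset.mem_insert.1 he with h0 | he1 <;> rcases Finset.mem_insert.1 hf with h0' | hf1
    · exact hne (h0.trans h0'.symm)
    · rw [h0] at hye
      rcases Sym2.mem_iff.1 hye with rfl | rfl
      · exact h1 f hf1 hyf
      · exact h2' f hf1 hyf
    · rw [h0'] at hyf
      rcases Sym2.mem_iff.1 hyf with rfl | rfl
      · exact h1 e he1 hye
      · exact h2' e he1 hye
    · exact hP.2 e (Finset.mem_of_mem_erase he1) f (Finset.mem_of_mem_erase hf1) hne y hye hyf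
  · rw [Finset.card_insert_of_notMem (fun h => h1 _ h (by simp)),
      Finset.card_erase_of_mem haxP, hPc]
    have := Finset.card_pos.2 ⟨_, haxP⟩
    omega
  · rintro ⟨e, he, hxe⟩
    rcases Finset.mem_insert.1 he with rfl | he
    · rcases Sym2.mem_iff.1 hxe with h | h
      · exact hadj.ne h.symm
      · exact hxd h
    · exact h1x e he hxe

/-- Structure of the trees in the family. -/
lemma memT_struct {V : Type*} [Fintype V] {T : SimpleGraph V} (hT : MemT T) (A : Finset V)
    (hA : ∀ x, x ∈ A ↔ x ∈ gallaiA T) :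
    nu T = A.card ∧ (∀ x, x ∈ gallaiD T ↔ x ∉ A) ∧ ∀ a b, T.Adj a b → (a ∈ A ↔ b ∉ A) := by
  classical
  obtain ⟨hT, hdeg, hn⟩ := hT
  have hE := hT.card_edgeFinset
  rw [Nat.card_eq_fintype_card, ← hE] at hn
  let C : Finset V := Finset.univ.filter (fun x => x ∉ gallaiD T ∧ x ∉ A)
  have hinc : ∀ a ∈ A, (T.incidenceFinset a).card ≤ 3 := by
    intro a ha
    rw [card_incidenceFinset_eq_degree, ← degree_eq_ncard]
    exact hdeg a ((hA a).1 ha)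
  obtain ⟨r⟩ := hT.connected.nonempty
  obtain ⟨p, hp⟩ := exists_parent hT r
  have hEsub : T.edgeFinset ⊆ A.biUnion (fun a => T.incidenceFinset a) ∪
      C.image (fun x => s(x, p x)) := by
    intro e he
    induction e using Sym2.ind with
    | _ x y =>
      have hxy : T.Adj x y := by simpa using he
      rw [Finset.mem_union, Finset.mem_biUnion, Finset.mem_image]
      by_cases hx : x ∈ A
      · left; exact ⟨x, hx, by simp [mem_incidenceFinset, mk'_mem_incidenceSet_iff, hxy]⟩
      by_cases hy : y ∈ A
      · left; exact ⟨y, hy, by simp [mem_incidenceFinset, mk'_mem_incidenceSet_iff, hxy]⟩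
      right
      have hxD : x ∉ gallaiD T := by
        intro hxD
        refine hy ((hA y).2 ⟨fun h => D_indep hT hxD h hxy, x, hxD, hxy.symm⟩)
      have hyD : y ∉ gallaiD T := by
        intro hyD
        refine hx ((hA x).2 ⟨fun h => D_indep hT h hyD hxy, y, hyD, hxy⟩)
      rcases hp x y hxy with h | h
      · exact ⟨x, by simp [C, hx, hxD], by rw [h.2]⟩
      · exact ⟨y, by simp [C, hy, hyD], by rw [h.2, Sym2.eq_swap]⟩
  have hle1 : T.edgeFinset.card ≤ A.card * 3 + C.card := by
    refine (Finset.card_le_card hEsub).trans ((Finset.card_union_le _ _).trans ?_)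
    exact Nat.add_le_add (Finset.card_biUnion_le_card_mul _ _ _ hinc) Finset.card_image_le
  -- matching side
  obtain ⟨M, hM, hMc⟩ := exists_max T
  have hcov : ∀ x, x ∉ gallaiD T → x ∈ covered M := by
    intro x hx
    by_contra h
    exact hx ⟨M, hM, hMc, h⟩
  have hAD : ∀ a ∈ A, a ∉ gallaiD T := fun a ha => ((hA a).1 ha).1
  have hm : ∀ a, ∃ x, a ∈ A → s(a, x) ∈ M := by
    intro a
    by_cases ha : a ∈ A
    · obtain ⟨e, he, hae⟩ := hcov a (hAD a ha)
      obtain ⟨x, rfl⟩ := hae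
      exact ⟨x, fun _ => he⟩
    · exact ⟨a, fun h => absurd h ha⟩
  choose m hm using hm
  have hmD : ∀ a ∈ A, m a ∈ gallaiD T := fun a ha => A_matched hT ((hA a).1 ha) hM hMc (hm a ha)
  have hle2 : A.card + A.card + C.card ≤ M.card * 2 := by
    have h1 : (A ∪ A.image m ∪ C).card = A.card + A.card + C.card := by
      rw [Finset.card_union_of_disjoint, Finset.card_union_of_disjoint, Finset.card_image_of_injOn]
      · intro a ha b hb hab
        by_contra hne
        refine hM.2 _ (hm a ha) _ (hm b hb) ?_ (m a) (by simp) (by simp [hab])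
        intro h
        rcases Sym2.eq_iff.1 h with h | h
        · exact hne h.1
        · exact hAD a ha (h.1 ▸ hmD b hb)
      · rw [Finset.disjoint_left]
        intro a ha h
        obtain ⟨b, hb, rfl⟩ := Finset.mem_image.1 h
        exact hAD _ ha (hmD b hb)
      · rw [Finset.disjoint_left]
        intro a ha h
        simp only [C, Finset.mem_filter] at h
        rcases Finset.mem_union.1 ha with ha | ha
        · exact h.2.2 ha
        · obtain ⟨b, hb, rfl⟩ := Finset.mem_image.1 ha
          exact h.2.1 (hmD b hb)
    rw [← h1]
    have h2 : A ∪ A.image m ∪ C ⊆ M.biUnion (fun e => e.toFinset) := by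
      intro x hx
      have hx' : x ∈ covered M := by
        rcases Finset.mem_union.1 hx with hx | hx
        · rcases Finset.mem_union.1 hx with hx | hx
          · exact hcov x (hAD x hx)
          · obtain ⟨b, hb, rfl⟩ := Finset.mem_image.1 hx
            exact ⟨_, hm b hb, by simp⟩
        · simp only [C, Finset.mem_filter] at hx
          exact hcov x hx.2.1
      obtain ⟨e, he, hxe⟩ := hx'
      exact Finset.mem_biUnion.2 ⟨e, he, by simpa using hxe⟩
    refine (Finset.card_le_card h2).trans (Finset.card_biUnion_le_card_mul _ _ _ ?_)
    intro e he
    rw [Sym2.card_toFinset]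
    split_ifs <;> omega
  have hC0 : C.card = 0 := by omega
  have hnu : nu T = A.card := by omega
  have hC : ∀ x, x ∉ gallaiD T → x ∈ A := by
    intro x hx
    by_contra h
    have : x ∈ C := by simp [C, hx, h]
    rw [Finset.card_eq_zero.1 hC0] at this
    simp at this
  refine ⟨hnu, fun x => ⟨fun h h' => hAD x h' h, fun h => ?_⟩, ?_⟩
  · by_contra h'
    exact h (hC x h')
  intro a b hab
  constructor
  · intro ha hb
    have hsub : T.edgeFinset ⊆ (A.erase a).biUnion (fun a => T.incidenceFinset a) ∪
        (T.incidenceFinset a).erase s(a, b) := by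
      intro e he
      have h := hEsub he
      rw [Finset.card_eq_zero.1 hC0, Finset.image_empty, Finset.union_empty,
        Finset.mem_biUnion] at h
      obtain ⟨c, hc, hce⟩ := h
      rw [Finset.mem_union, Finset.mem_biUnion, Finset.mem_erase]
      by_cases hca : c = a
      · subst hca
        by_cases heb : e = s(c, b)
        · left
          exact ⟨b, Finset.mem_erase.2 ⟨hab.ne', hb⟩,
            by simp [heb, mem_incidenceFinset, mk'_mem_incidenceSet_iff, hab]⟩
        · exact Or.inr ⟨heb, hce⟩
      · exact Or.inl ⟨c, Finset.mem_erase.2 ⟨hca, hc⟩, hce⟩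
    have h1 := (Finset.card_le_card hsub).trans (Finset.card_union_le _ _)
    have h2 := Finset.card_biUnion_le_card_mul (A.erase a) (fun a => T.incidenceFinset a) 3
      (fun c hc => hinc c (Finset.mem_of_mem_erase hc))
    have h3 : s(a, b) ∈ T.incidenceFinset a := by
      simp [mem_incidenceFinset, mk'_mem_incidenceSet_iff, hab]
    rw [Finset.card_erase_of_mem h3] at h1
    rw [Finset.card_erase_of_mem ha] at h2
    have h4 := hinc a ha
    have h5 := Finset.card_pos.2 ⟨_, h3⟩
    have h6 := Finset.card_pos.2 ⟨_, ha⟩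
    omega
  · intro hb
    apply hC
    intro haD
    refine hb ((hA b).2 ⟨fun h => D_indep hT haD h hab, a, haD, hab.symm⟩)

lemma deg_ge {V : Type*} [Fintype V] {T : SimpleGraph V} (hT : T.IsTree) (A : Finset V)
    (hA : ∀ a b, T.Adj a b → (a ∈ A ↔ b ∉ A)) (hd : ∀ a ∈ A, (T.neighborSet a).ncard ≤ 3)
    (hc : 3 * A.card + 1 = Fintype.card V) (a : V) (ha : a ∈ A) :
    3 ≤ (T.neighborSet a).ncard := by
  classical
  have hE := hT.card_edgeFinset
  have hsub : T.edgeFinset ⊆ (A.erase a).biUnion (fun a => T.incidenceFinset a) ∪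
        T.incidenceFinset a := by
    intro e he
    induction e using Sym2.ind with
    | _ x y =>
      have hxy : T.Adj x y := by simpa using he
      rw [Finset.mem_union, Finset.mem_biUnion]
      have : ∃ c ∈ A, s(x, y) ∈ T.incidenceFinset c := by
        by_cases hx : x ∈ A
        · exact ⟨x, hx, by simp [mem_incidenceFinset, mk'_mem_incidenceSet_iff, hxy]⟩
        · have hy : y ∈ A := by
            by_contra hy
            exact hx ((hA _ _ hxy).2 hy)
          exact ⟨y, hy, by simp [mem_incidenceFinset, mk'_mem_incidenceSet_iff, hxy]⟩
      obtain ⟨c, hc, hce⟩ := this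
      by_cases hca : c = a
      · exact Or.inr (hca ▸ hce)
      · exact Or.inl ⟨c, Finset.mem_erase.2 ⟨hca, hc⟩, hce⟩
  have h1 := (Finset.card_le_card hsub).trans (Finset.card_union_le _ _)
  have h2 := Finset.card_biUnion_le_card_mul (A.erase a) (fun a => T.incidenceFinset a) 3
    (fun c hc => by
      rw [card_incidenceFinset_eq_degree, ← degree_eq_ncard]
      exact hd c (Finset.mem_of_mem_erase hc))
  rw [card_incidenceFinset_eq_degree, ← degree_eq_ncard] at h1
  rw [Finset.card_erase_of_mem ha] at h2
  have h6 := Finset.card_pos.2 ⟨_, ha⟩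
  omega

open Classical in
/-- The contraction map. -/
noncomputable def contr {V : Type*} (S : Set V) (x : V) : Option {x : V // x ∉ S} :=
  if h : x ∈ S then none else some ⟨x, h⟩

lemma contr_mem {V : Type*} {S : Set V} {x : V} (h : x ∈ S) : contr S x = none := by
  simp [contr, h]

lemma contr_not_mem {V : Type*} {S : Set V} {x : V} (h : x ∉ S) : contr S x = some ⟨x, h⟩ := by
  simp [contr, h]

lemma contr_adj {V : Type*} {T : SimpleGraph V} {S : Set V} {x y : V} (h : T.Adj x y) :
    contr S x = contr S y ∨ (contractSet T S).Adj (contr S x) (contr S y) := by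
  by_cases hx : x ∈ S <;> by_cases hy : y ∈ S
  · left; rw [contr_mem hx, contr_mem hy]
  · right; rw [contr_mem hx, contr_not_mem hy]; exact ⟨x, hx, h.symm⟩
  · right; rw [contr_mem hy, contr_not_mem hx]; exact ⟨y, hy, h⟩
  · right; rw [contr_not_mem hx, contr_not_mem hy]; exact h

lemma contr_reach {V : Type*} {T : SimpleGraph V} {S : Set V} {x y : V} (w : T.Walk x y) :
    (contractSet T S).Reachable (contr S x) (contr S y) := by
  induction w with
  | nil => exact Reachable.refl _
  | cons h _ ih =>
    rcases contr_adj (S := S) h with h' | h'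
    · rwa [h']
    · exact h'.reachable.trans ih

lemma contr_isTree {V : Type*} [Fintype V] {T : SimpleGraph V} (hT : T.IsTree) (v : V)
    (hd : (T.neighborSet v).ncard = 3) (S : Set V) (hS : S = insert v (T.neighborSet v)) :
    (contractSet T S).IsTree ∧ Nat.card (Option {x : V // x ∉ S}) + 3 = Nat.card V := by
  classical
  have hvS : v ∈ S := by simp [hS]
  have hScard : S.ncard = 4 := by
    rw [hS, Set.ncard_insert_of_notMem (by simp), hd]
  have hcard : Nat.card (Option {x : V // x ∉ S}) + 3 = Nat.card V := by
    have h1 : Nat.card {x : V // x ∉ S} = Sᶜ.ncard := Nat.card_coe_set_eq Sᶜ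
    have h2 := Set.ncard_add_ncard_compl S
    rw [Finite.card_option, h1]
    omega
  have hconn : (contractSet T S).Connected := by
    have : Nonempty (Option {x : V // x ∉ S}) := ⟨none⟩
    have hsurj : ∀ z, ∃ x, contr S x = z := by
      rintro (_ | ⟨x, hx⟩)
      · exact ⟨v, contr_mem hvS⟩
      · exact ⟨x, contr_not_mem hx⟩
    refine ⟨fun z z' => ?_⟩
    obtain ⟨x, rfl⟩ := hsurj z
    obtain ⟨y, rfl⟩ := hsurj z'
    obtain ⟨w⟩ := hT.connected x y
    exact contr_reach w
  refine ⟨isTree_iff_connected_and_card.2 ⟨hconn, le_antisymm ?_ hconn.card_vert_le_card_edgeSet_add_one⟩, hcard⟩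
  have hE := hT.card_edgeFinset
  have hsub : (contractSet T S).edgeFinset ⊆
      (T.edgeFinset \ T.incidenceFinset v).image (Sym2.map (contr S)) := by
    have aux : ∀ (x : {x : V // x ∉ S}) (u : V), u ≠ v → T.Adj x u →
        s(some x, contr S u) ∈
          (T.edgeFinset \ T.incidenceFinset v).image (Sym2.map (contr S)) := by
      intro x u hu hxu
      refine Finset.mem_image.2 ⟨s(x, u), ?_, ?_⟩
      · rw [Finset.mem_sdiff]
        refine ⟨by simpa using hxu, ?_⟩
        have hxv : (x : V) ≠ v := fun h => x.2 (h ▸ hvS)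
        simp only [mem_incidenceFinset, mk'_mem_incidenceSet_iff, not_and, not_or]
        exact fun _ => ⟨hxv.symm, hu.symm⟩
      · simp [contr_not_mem x.2]
    have aux2 : ∀ (x : {x : V // x ∉ S}), (contractSet T S).Adj (some x) none →
        s(some x, none) ∈
          (T.edgeFinset \ T.incidenceFinset v).image (Sym2.map (contr S)) := by
      rintro x ⟨u, hu, hxu⟩
      have := aux x u (fun h => x.2 ?_) hxu
      · rwa [contr_mem hu] at this
      · subst h
        exact hS.ge (Set.mem_insert_of_mem _ hxu.symm)
    intro e he
    induction e using Sym2.ind with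
    | _ z z' =>
      have hzz : (contractSet T S).Adj z z' := by simpa using he
      rcases z with _ | x <;> rcases z' with _ | y
      · exact absurd hzz (by simp)
      · rw [Sym2.eq_swap]
        exact aux2 y hzz.symm
      · exact aux2 x hzz
      · have := aux x y (fun h => y.2 (h ▸ hvS)) hzz
        rwa [contr_not_mem y.2] at this
  have h1 := (Finset.card_le_card hsub).trans Finset.card_image_le
  rw [Finset.card_sdiff_of_subset (incidenceFinset_subset T v), card_incidenceFinset_eq_degree,
    ← degree_eq_ncard, hd] at h1
  rw [Nat.card_eq_fintype_card, ← edgeFinset_card]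
  rw [Nat.card_eq_fintype_card (α := V)] at hcard
  have h3 := T.degree_le_card_edgeFinset v
  rw [← degree_eq_ncard, hd] at h3
  omega

/-- Lemma 5 of the paper. Let `T ∈ 𝒯`, let `v ∈ A_T` with
`N_T(v) = {u₁, u₂, u₃}`, and let `T'` be obtained from `T` by contracting the
edges `vu₁`, `vu₂`, `vu₃` into one new vertex `w` (the vertex `none` of
`contractSet T {v, u₁, u₂, u₃}`). Then `T' ∈ 𝒯`,
`D_{T'} = {w} ∪ (D_T \ N_T(v))`, and `A_{T'} = A_T \ {v}`. -/
theorem statement10 {V : Type} [Fintype V] (T : SimpleGraph V) (hT : MemT T)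
    (v u₁ u₂ u₃ : V) (hv : v ∈ gallaiA T)
    (h12 : u₁ ≠ u₂) (h13 : u₁ ≠ u₃) (h23 : u₂ ≠ u₃)
    (hN : T.neighborSet v = {u₁, u₂, u₃})
    (S : Set V) (hS : S = {v, u₁, u₂, u₃}) :
    MemT (contractSet T S) ∧
    gallaiD (contractSet T S) =
      insert none (some '' {x : {x : V // x ∉ S} |
        (x : V) ∈ gallaiD T \ T.neighborSet v}) ∧
    gallaiA (contractSet T S) =
      some '' {x : {x : V // x ∉ S} | (x : V) ∈ gallaiA T ∧ (x : V) ≠ v} := by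
  classical
  have hvN : v ∉ T.neighborSet v := by simp
  have hd3 : (T.neighborSet v).ncard = 3 := by
    rw [hN, Set.ncard_eq_three]
    exact ⟨u₁, u₂, u₃, h12, h13, h23, rfl⟩
  have hS' : S = insert v (T.neighborSet v) := by rw [hS, hN]
  obtain ⟨A, hA⟩ : ∃ A : Finset V, ∀ x, x ∈ A ↔ x ∈ gallaiA T :=
    ⟨(gallaiA T).toFinset, by simp⟩
  obtain ⟨hnu, hD, hbip⟩ := memT_struct hT A hA
  obtain ⟨hTree, hcard⟩ := contr_isTree hT.1 v hd3 S hS'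
  have hvA : v ∈ A := (hA v).2 hv
  have hNA : ∀ x ∈ T.neighborSet v, x ∉ A := fun x hx => (hbip v x hx).1 hvA
  have hAS : ∀ x ∈ A, x ≠ v → x ∉ S := by
    intro x hx hne h
    rw [hS'] at h
    rcases h with h | h
    · exact hne h
    · exact hNA x h hx
  have hvS : v ∈ S := by simp [hS']
  set A' : Finset (Option {x : V // x ∉ S}) := (A.erase v).image (contr S) with hA'
  have hmem : ∀ x : {x : V // x ∉ S}, some x ∈ A' ↔ (x : V) ∈ A := by
    intro x
    simp only [hA', Finset.mem_image, Finset.mem_erase]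
    constructor
    · rintro ⟨y, ⟨hy, hyA⟩, h⟩
      rw [contr_not_mem (hAS y hyA hy)] at h
      obtain rfl := Option.some.inj h
      exact hyA
    · intro h
      exact ⟨x, ⟨fun h' => x.2 (h' ▸ hvS), h⟩, contr_not_mem x.2⟩
  have hnone : none ∉ A' := by
    simp only [hA', Finset.mem_image, Finset.mem_erase, not_exists, not_and]
    rintro y ⟨hy, hyA⟩ h
    rw [contr_not_mem (hAS y hyA hy)] at h
    simp at h
  have hA'card : A'.card + 1 = A.card := by
    rw [hA', Finset.card_image_of_injOn, Finset.card_erase_of_mem hvA]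
    · have := Finset.card_pos.2 ⟨_, hvA⟩
      omega
    · intro x hx y hy h
      rw [Finset.mem_coe, Finset.mem_erase] at hx hy
      rw [contr_not_mem (hAS x hx.2 hx.1), contr_not_mem (hAS y hy.2 hy.1)] at h
      exact congrArg Subtype.val (Option.some.inj h)
  have hnot : ∀ (x : {x : V // x ∉ S}), (contractSet T S).Adj (some x) none → (x : V) ∈ A := by
    rintro x ⟨u, hu, hxu⟩
    rw [hS'] at hu
    rcases hu with rfl | hu
    · exact absurd (hS'.ge (Set.mem_insert_of_mem _ hxu.symm)) x.2
    · exact (hbip _ _ hxu).2 (hNA u hu)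
  have hbip' : ∀ a b, (contractSet T S).Adj a b → (a ∈ A' ↔ b ∉ A') := by
    rintro (_ | x) (_ | y) h
    · exact absurd h (by simp)
    · simp [hnone, hmem, hnot y h.symm]
    · simp [hnone, hmem, hnot x h]
    · rw [hmem, hmem]
      exact hbip _ _ h
  have hdeg' : ∀ a ∈ A', ((contractSet T S).neighborSet a).ncard ≤ 3 := by
    rintro (_ | x) hx
    · exact absurd hx hnone
    · have hxA := (hmem x).1 hx
      refine le_trans ?_ (hT.2.1 x ((hA _).1 hxA))
      refine le_trans (Set.ncard_le_ncard (t := contr S '' T.neighborSet x) ?_ (Set.toFinite _))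
        (Set.ncard_image_le (Set.toFinite _))
      rintro (_ | y) h
      · obtain ⟨u, hu, hxu⟩ := h
        exact ⟨u, hxu, contr_mem hu⟩
      · exact ⟨y, h, contr_not_mem y.2⟩
  have hc3 : 3 * A'.card + 1 = Nat.card (Option {x : V // x ∉ S}) := by
    have := hT.2.2
    omega
  have hge := deg_ge hTree A' hbip' hdeg' (by rw [hc3, Nat.card_eq_fintype_card])
  obtain ⟨hnu', hD', hAA'⟩ := nu_of_bip hTree A' hbip' (fun a ha => le_trans (by omega) (hge a ha))
  refine ⟨⟨hTree, ?_, ?_⟩, ?_, ?_⟩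
  · intro a ha
    rw [hAA'] at ha
    exact hdeg' a ha
  · rw [hnu', hc3]
  · rw [hD']
    ext (_ | x)
    · simp [hnone]
    · have hxN : (x : V) ∉ T.neighborSet v := fun h => x.2 (hS'.ge (Set.mem_insert_of_mem _ h))
      have h1 : some x ∈ {x | x ∉ A'} ↔ (x : V) ∉ A := not_congr (hmem x)
      rw [h1]
      constructor
      · intro h
        exact Or.inr ⟨x, ⟨(hD x).2 h, hxN⟩, rfl⟩
      · rintro (h | ⟨y, hy, h⟩)
        · simp at h
        · obtain rfl := Option.some.inj h
          exact (hD _).1 hy.1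
  · rw [hAA']
    ext (_ | x)
    · simp [hnone]
    · have h1 : some x ∈ {x | x ∈ A'} ↔ (x : V) ∈ A := hmem x
      rw [h1]
      constructor
      · intro h
        exact ⟨x, ⟨(hA _).1 h, fun h' => x.2 (h' ▸ hvS)⟩, rfl⟩
      · rintro ⟨y, hy, h⟩
        obtain rfl := Option.some.inj h
        exact (hA _).2 hy.1

end URPaper
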